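/- arXiv:2003.05236 — 2 statements merged into one kernel-verified Lean document; each statement's English description precedes it below -/
import Mathlib

section
/- Let w be an odd positive integer, ε ∈ {+1,−1}, and q ∈ V_{w+1}^ε. Assume q(X,Y) = −ε·q(Y,X) and that (∂/∂Y − ∂/∂X)[q(X,Y) − q(X+Y,Y) + ε·q(X+Y,X)] lies in V_w^{−ε}. Then there exists c ∈ ℚ such that q(X,Y) − q(X+Y,Y) + ε·q(X+Y,X) = c·(X+Y)^{w+1}, and moreover c = 0 when ε = +1. -/
open MvPolynomial

/-- Substitution: `sub2 a b p` is `p(a, b)` for a bivariate polynomial `p(X,Y)`. -/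
noncomputable def sub2 (a b p : MvPolynomial (Fin 2) ℚ) : MvPolynomial (Fin 2) ℚ :=
  aeval ![a, b] p

/-- `memV w ε p` : `p ∈ V_w^ε`, i.e. `p` is homogeneous of degree `w` and
`p(-X,Y) = ε p(X,Y)`. -/
def memV (w : ℕ) (ε : ℤ) (p : MvPolynomial (Fin 2) ℚ) : Prop :=
  p.IsHomogeneous w ∧ sub2 (-X 0) (X 1) p = (ε : ℚ) • p

/-- `memW w ε p` : `p ∈ W_w^ε`, the space of period polynomials: `p ∈ V_w^ε` with
`p(X,Y) + p(-Y,X) = 0` and `p(X,Y) + p(X-Y,X) + p(-Y,X-Y) = 0`. -/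
def memW (w : ℕ) (ε : ℤ) (p : MvPolynomial (Fin 2) ℚ) : Prop :=
  memV w ε p ∧
  p + sub2 (-X 1) (X 0) p = 0 ∧
  p + sub2 (X 0 - X 1) (X 0) p + sub2 (-X 1) (X 0 - X 1) p = 0

lemma sub2_add (a b p r : MvPolynomial (Fin 2) ℚ) :
    sub2 a b (p + r) = sub2 a b p + sub2 a b r := map_add _ _ _

lemma sub2_sub (a b p r : MvPolynomial (Fin 2) ℚ) :
    sub2 a b (p - r) = sub2 a b p - sub2 a b r := map_sub _ _ _

lemma sub2_neg (a b p : MvPolynomial (Fin 2) ℚ) : sub2 a b (-p) = -sub2 a b p := map_neg _ _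

lemma sub2_smul (a b p : MvPolynomial (Fin 2) ℚ) (c : ℚ) :
    sub2 a b (c • p) = c • sub2 a b p := map_smul _ _ _

lemma sub2_pow (a b p : MvPolynomial (Fin 2) ℚ) (n : ℕ) :
    sub2 a b (p ^ n) = sub2 a b p ^ n := map_pow _ _ _

@[simp] lemma sub2_X_zero (a b : MvPolynomial (Fin 2) ℚ) : sub2 a b (X 0) = a := by simp [sub2]

@[simp] lemma sub2_X_one (a b : MvPolynomial (Fin 2) ℚ) : sub2 a b (X 1) = b := by simp [sub2]

lemma sub2_X_X (p : MvPolynomial (Fin 2) ℚ) : sub2 (X 0) (X 1) p = p := by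
  have : ![X 0, X 1] = (X : Fin 2 → MvPolynomial (Fin 2) ℚ) := by
    ext i : 1; fin_cases i <;> rfl
  rw [sub2, this, aeval_X_left_apply]

lemma sub2_sub2 (a b c d p : MvPolynomial (Fin 2) ℚ) :
    sub2 a b (sub2 c d p) = sub2 (sub2 a b c) (sub2 a b d) p := by
  unfold sub2
  rw [← AlgHom.comp_apply, comp_aeval]
  congr 2
  ext i : 1
  fin_cases i <;> rfl

/-- The chain rule for partial derivatives of a substitution. -/
lemma pderiv_sub2 (i : Fin 2) (a b p : MvPolynomial (Fin 2) ℚ) :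
    pderiv i (sub2 a b p) =
      sub2 a b (pderiv 0 p) * pderiv i a + sub2 a b (pderiv 1 p) * pderiv i b := by
  unfold sub2
  induction p using MvPolynomial.induction_on with
  | C r => simp [← algebraMap_eq]
  | add p r hp hr => simp only [map_add, hp, hr]; ring
  | mul_X p j hp =>
    rw [map_mul, aeval_X, pderiv_mul, hp, pderiv_mul, pderiv_mul]
    fin_cases j <;> simp [-aeval_eq_bind₁] <;> ring

lemma isHomogeneous_sub2 {n : ℕ} {a b p : MvPolynomial (Fin 2) ℚ} (hp : p.IsHomogeneous n)
    (ha : a.IsHomogeneous 1) (hb : b.IsHomogeneous 1) : (sub2 a b p).IsHomogeneous n := by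
  have := hp.aeval ![a, b] (n := 1) (by intro i; fin_cases i <;> assumption)
  rwa [one_mul] at this

lemma sub2_neg_X_neg_X {n : ℕ} {p : MvPolynomial (Fin 2) ℚ} (hp : p.IsHomogeneous n) :
    sub2 (-X 0) (-X 1) p = (-1 : ℚ) ^ n • p := by
  rw [sub2, p.as_sum, map_sum, Finset.smul_sum]
  refine Finset.sum_congr rfl fun d hd => ?_
  have hdeg : d 0 + d 1 = n := by
    have := hp (mem_support_iff.mp hd)
    simpa [Finsupp.weight_apply, Finsupp.sum_fintype] using this
  rw [aeval_monomial, monomial_eq, Finsupp.prod_fintype _ _ (by simp),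
    Finsupp.prod_fintype _ _ (by simp), Fin.prod_univ_two, Fin.prod_univ_two, ← hdeg,
    smul_eq_C_mul, algebraMap_eq]
  simp only [Matrix.cons_val_zero, Matrix.cons_val_one, map_pow, map_neg, map_one]
  rw [neg_pow (X 0 : MvPolynomial (Fin 2) ℚ), neg_pow (X 1 : MvPolynomial (Fin 2) ℚ), pow_add]
  ring

lemma eq_smul_X_one_pow {n : ℕ} {p : MvPolynomial (Fin 2) ℚ} (hp : p.IsHomogeneous n)
    (h : pderiv 0 p = 0) : p = coeff (Finsupp.single 1 n) p • X 1 ^ n := by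
  ext m
  rw [coeff_smul, coeff_X_pow, smul_eq_mul, mul_ite, mul_one, mul_zero]
  split_ifs with hm
  · rw [← hm]
  · by_contra hne
    have hdeg : m 0 + m 1 = n := by
      have := hp hne
      simpa [Finsupp.weight_apply, Finsupp.sum_fintype] using this
    have h0 : m 0 ≠ 0 := by
      intro h0
      refine hm (Finsupp.ext fun i => ?_)
      fin_cases i <;> simp <;> omega
    have hle : Finsupp.single 0 1 ≤ m := by
      rw [Finsupp.single_le_iff]; omega
    have hc := congrArg (coeff (m - Finsupp.single 0 1)) h
    rw [coeff_pderiv, tsub_add_cancel_of_le hle, coeff_zero] at hc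
    rcases mul_eq_zero.mp hc with hc | hc
    · exact hne hc
    · norm_cast at hc

/-- A form killed by `∂/∂Y - ∂/∂X` is a multiple of a power of `X + Y`. -/
lemma exists_eq_smul_X_add_X_pow {n : ℕ} {p : MvPolynomial (Fin 2) ℚ} (hp : p.IsHomogeneous n)
    (h : pderiv 1 p - pderiv 0 p = 0) : ∃ c : ℚ, p = c • (X 0 + X 1) ^ n := by
  have h0 := isHomogeneous_X ℚ (0 : Fin 2)
  have h1 := isHomogeneous_X ℚ (1 : Fin 2)
  have hd : pderiv 0 (sub2 (X 0) (X 1 - X 0) p) = 0 := by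
    rw [pderiv_sub2, sub_eq_zero.mp h]
    simp [pderiv_X]
  have key := eq_smul_X_one_pow (isHomogeneous_sub2 hp h0 (h1.sub h0)) hd
  refine ⟨coeff (Finsupp.single 1 n) (sub2 (X 0) (X 1 - X 0) p), ?_⟩
  calc p = sub2 (X 0) (X 0 + X 1) (sub2 (X 0) (X 1 - X 0) p) := by
        rw [sub2_sub2, sub2_sub, sub2_X_zero, sub2_X_one, add_sub_cancel_left, sub2_X_X]
    _ = _ := by
      conv_lhs => rw [key]
      rw [sub2_smul, sub2_pow, sub2_X_one]

/-- An odd-degree form with opposite signs under `X ↦ -X` and `X ↔ Y` vanishes. -/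
lemma eq_zero_of_memV_of_swap {w : ℕ} (hw : Odd w) {ε : ℤ} (hε : ε = 1 ∨ ε = -1)
    {g : MvPolynomial (Fin 2) ℚ} (hg : memV w (-ε) g)
    (hswap : sub2 (X 1) (X 0) g = (ε : ℚ) • g) : g = 0 := by
  obtain ⟨hhom, hneg⟩ := hg
  have hodd := sub2_neg_X_neg_X hhom
  rw [hw.neg_one_pow] at hodd
  have hY : sub2 (X 0) (-X 1) g = (ε : ℚ) • g := by
    have := congrArg (sub2 (-X 0) (-X 1)) hneg
    simp only [sub2_sub2, sub2_neg, sub2_X_zero, sub2_X_one, sub2_smul, neg_neg, hodd] at this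
    rw [this]
    push_cast
    module
  have hX := congrArg (sub2 (-X 0) (X 1)) hswap
  have hY' := congrArg (sub2 (X 1) (X 0)) hY
  simp only [sub2_sub2, sub2_neg, sub2_X_zero, sub2_X_one, sub2_smul] at hX hY'
  rw [hY', hswap, hneg] at hX
  rcases hε with rfl | rfl
  all_goals
    push_cast at hX
    simp only [one_smul, neg_smul, smul_neg, neg_neg] at hX
    exact self_eq_neg.mp hX

theorem stmt6 (w : ℕ) (hw : Odd w) (hpos : 0 < w) (ε : ℤ) (hε : ε = 1 ∨ ε = -1)
    (q : MvPolynomial (Fin 2) ℚ) (hq : memV (w + 1) ε q)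
    (hsym : q = -((ε : ℚ) • sub2 (X 1) (X 0) q))
    (h : memV w (-ε)
      (pderiv 1 (q - sub2 (X 0 + X 1) (X 1) q + (ε : ℚ) • sub2 (X 0 + X 1) (X 0) q)
        - pderiv 0 (q - sub2 (X 0 + X 1) (X 1) q + (ε : ℚ) • sub2 (X 0 + X 1) (X 0) q))) :
    ∃ c : ℚ,
      (q - sub2 (X 0 + X 1) (X 1) q + (ε : ℚ) • sub2 (X 0 + X 1) (X 0) q
        = c • (X 0 + X 1 : MvPolynomial (Fin 2) ℚ) ^ (w + 1)) ∧ (ε = 1 → c = 0) := by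
  have h0 := isHomogeneous_X ℚ (0 : Fin 2)
  have h1 := isHomogeneous_X ℚ (1 : Fin 2)
  have hε2 : (ε : ℚ) * ε = 1 := by rcases hε with rfl | rfl <;> norm_num
  set F := q - sub2 (X 0 + X 1) (X 1) q + (ε : ℚ) • sub2 (X 0 + X 1) (X 0) q with hF
  have hFhom : F.IsHomogeneous (w + 1) := by
    refine (hq.1.sub (isHomogeneous_sub2 hq.1 (h0.add h1) h1)).add ?_
    rw [smul_eq_C_mul]
    exact (isHomogeneous_sub2 hq.1 (h0.add h1) h0).C_mul _
  have hqswap : sub2 (X 1) (X 0) q = -((ε : ℚ) • q) := by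
    conv_rhs => rw [hsym]
    rw [smul_neg, smul_smul, hε2, one_smul, neg_neg]
  have hFswap : sub2 (X 1) (X 0) F = -((ε : ℚ) • F) := by
    rw [hF]
    simp only [sub2_add, sub2_sub, sub2_smul, sub2_sub2, sub2_X_zero, sub2_X_one, hqswap,
      smul_add, smul_sub, smul_smul, hε2, one_smul]
    rw [add_comm (X 1) (X 0)]
    abel
  have hG : pderiv 1 F - pderiv 0 F = 0 := by
    refine eq_zero_of_memV_of_swap hw hε h ?_
    have e0 := congrArg (pderiv 0) hFswap
    have e1 := congrArg (pderiv 1) hFswap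
    rw [pderiv_sub2] at e0 e1
    simp only [pderiv_X_self, pderiv_X_of_ne zero_ne_one, pderiv_X_of_ne one_ne_zero,
      mul_zero, mul_one, zero_add, add_zero, map_neg, Derivation.map_smul] at e0 e1
    rw [sub2_sub, e0, e1]
    module
  obtain ⟨c, hc⟩ := exists_eq_smul_X_add_X_pow hFhom hG
  refine ⟨c, hc, ?_⟩
  rintro rfl
  have hdiag := congrArg (sub2 1 1) hqswap
  have hpt := congrArg (sub2 1 0) hc
  rw [hF] at hpt
  simp only [sub2_add, sub2_sub, sub2_smul, sub2_neg, sub2_pow, sub2_sub2, sub2_X_zero,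
    sub2_X_one, Int.cast_one, one_smul, add_zero, one_pow, sub_self, zero_add] at hdiag hpt
  rw [self_eq_neg.mp hdiag] at hpt
  exact (smul_eq_zero.mp hpt.symm).resolve_right one_ne_zero
end

section
/- Let w be a positive even integer and p ∈ V_w^+. Then p(X,X+Y) + p(X+Y,Y) − p(−X,−X+Y) − p(−X+Y,Y) = 0 if and only if p satisfies both p(X,Y) + p(X−Y,X) + p(−Y,X−Y) = 0 and p(−Y,X) + p(−X,X−Y) + p(−X+Y,−Y) = 0 (that is, if and only if p is an even period polynomial for the index-three congruence subgroup Γ_A of SL₂(ℤ)). -/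
open MvPolynomial

theorem eval_sub2 (v : Fin 2 → ℚ) (a b p : MvPolynomial (Fin 2) ℚ) :
    eval v (sub2 a b p) = eval ![eval v a, eval v b] p := by
  have h : (eval v).comp (aeval ![a, b]).toRingHom = eval ![eval v a, eval v b] := by
    ext i
    · simp
    · fin_cases i <;> simp
  exact DFunLike.congr_fun h p

theorem MvPolynomial.IsHomogeneous.eval_smul_pair {w : ℕ} {p : MvPolynomial (Fin 2) ℚ}
    (hp : p.IsHomogeneous w) (t x y : ℚ) :
    eval ![t * x, t * y] p = t ^ w * eval ![x, y] p := by
  rw [eval_eq', eval_eq', Finset.mul_sum]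
  refine Finset.sum_congr rfl fun d hd => ?_
  have hw := hp (mem_support_iff.mp hd)
  rw [Finsupp.weight_apply, Finsupp.sum_fintype _ _ (by simp), Fin.sum_univ_two] at hw
  simp only [Pi.one_apply, smul_eq_mul, mul_one] at hw
  simp only [Fin.prod_univ_two, Matrix.cons_val_zero, Matrix.cons_val_one]
  rw [← hw]
  ring

/-- A bivariate polynomial invariant under `X ↦ X + 2Y` takes the same value at all points of the
line `Y = 1`. -/
theorem eval_eq_of_shift_invariant (r : MvPolynomial (Fin 2) ℚ)
    (h : ∀ x y : ℚ, eval ![x + 2 * y, y] r = eval ![x, y] r) (x : ℚ) :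
    eval ![x, 1] r = eval ![0, 1] r := by
  let q : Polynomial ℚ := aeval ![Polynomial.X, 1] r
  have hq (x : ℚ) : q.eval x = eval ![x, 1] r := by
    have h : (Polynomial.evalRingHom x).comp
        (aeval ![(Polynomial.X : Polynomial ℚ), 1]).toRingHom = eval ![x, 1] := by
      ext i
      · simp
      · fin_cases i <;> simp
    exact DFunLike.congr_fun h r
  have hn (n : ℕ) : eval ![2 * (n : ℚ), 1] r = eval ![0, 1] r := by
    induction n with
    | zero => simp
    | succ n ih =>
      rw [← ih, ← h (2 * (n : ℚ)) 1]
      congr 3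
      push_cast
      ring
  have hconst : q = Polynomial.C (eval ![0, 1] r) := by
    apply Polynomial.eq_of_infinite_eval_eq
    refine (Set.infinite_range_of_injective (f := fun n : ℕ => 2 * (n : ℚ)) ?_).mono ?_
    · intro a b hab
      simpa using hab
    · rintro _ ⟨n, rfl⟩
      simp [hq, hn]
  rw [← hq, hconst, Polynomial.eval_C]

/-- A homogeneous polynomial of positive degree which is even in each variable and invariant under
`(X, Y) ↦ (X - Y, X)` vanishes. -/
theorem eq_zero_of_even_of_invariant {w : ℕ} (hpos : 0 < w) {r : MvPolynomial (Fin 2) ℚ}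
    (hr : r.IsHomogeneous w)
    (hX : ∀ x y : ℚ, eval ![-x, y] r = eval ![x, y] r)
    (hY : ∀ x y : ℚ, eval ![x, -y] r = eval ![x, y] r)
    (hU : ∀ x y : ℚ, eval ![x - y, x] r = eval ![x, y] r) : r = 0 := by
  have hshift (x y : ℚ) : eval ![x + 2 * y, y] r = eval ![x, y] r := by
    have h1 := hU y (x + y)
    have h2 := hU y (-(x + y))
    rw [hY, ← h1] at h2
    rw [← hX x y]
    convert h2 using 4 <;> ring
  have hline (x y : ℚ) (hy : y ≠ 0) : eval ![x, y] r = y ^ w * eval ![0, 1] r := by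
    rw [← eval_eq_of_shift_invariant r hshift (x / y), ← hr.eval_smul_pair]
    congr 3
    · field_simp
    · simp
  have hc : eval ![0, 1] r = 0 := by
    have h := hU 2 1
    rw [hline _ _ two_ne_zero, hline 2 1 one_ne_zero, one_pow] at h
    have h2 : (1 : ℚ) < 2 ^ w := one_lt_pow₀ one_lt_two hpos.ne'
    have h3 : ((2 : ℚ) ^ w - 1) * eval ![0, 1] r = 0 := by linear_combination h
    exact (mul_eq_zero.mp h3).resolve_left (by linarith)
  have hvanish (x y : ℚ) (hy : y ≠ 0) : eval ![x, y] r = 0 := by rw [hline x y hy, hc, mul_zero]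
  apply MvPolynomial.funext
  intro v
  obtain ⟨x, y, rfl⟩ : ∃ x y, v = ![x, y] := ⟨v 0, v 1, by ext i; fin_cases i <;> rfl⟩
  rw [map_zero]
  by_cases hy : y = 0
  · subst hy
    by_cases hx : x = 0
    · subst hx
      simpa [hpos.ne'] using hr.eval_smul_pair 0 0 0
    · rw [← hU, hvanish _ _ hx]
  · exact hvanish x y hy

theorem sub2_isHomogeneous {w : ℕ} {a b p : MvPolynomial (Fin 2) ℚ} (hp : p.IsHomogeneous w)
    (ha : a.IsHomogeneous 1) (hb : b.IsHomogeneous 1) : (sub2 a b p).IsHomogeneous w := by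
  have h := hp.aeval ![a, b] (n := 1) (by intro i; fin_cases i <;> simpa)
  simpa [sub2] using h

theorem eq_zero_iff_eval_pair (r : MvPolynomial (Fin 2) ℚ) :
    r = 0 ↔ ∀ x y : ℚ, eval ![x, y] r = 0 := by
  refine ⟨fun h x y => by rw [h, map_zero], fun h => MvPolynomial.funext fun v => ?_⟩
  have hv : v = ![v 0, v 1] := by ext i; fin_cases i <;> rfl
  rw [hv, h, map_zero]

theorem stmt8 (w : ℕ) (hw : Even w) (hpos : 0 < w)
    (p : MvPolynomial (Fin 2) ℚ) (hp : memV w 1 p) :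
    (sub2 (X 0) (X 0 + X 1) p + sub2 (X 0 + X 1) (X 1) p
        - sub2 (-X 0) (-X 0 + X 1) p - sub2 (-X 0 + X 1) (X 1) p = 0)
      ↔ ((p + sub2 (X 0 - X 1) (X 0) p + sub2 (-X 1) (X 0 - X 1) p = 0) ∧
          (sub2 (-X 1) (X 0) p + sub2 (-X 0) (X 0 - X 1) p
            + sub2 (-X 0 + X 1) (-X 1) p = 0)) := by
  obtain ⟨hhom, heven⟩ := hp
  have hX (x y : ℚ) : eval ![-x, y] p = eval ![x, y] p := by
    simpa [eval_sub2] using congrArg (eval ![x, y]) heven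
  have hneg (x y : ℚ) : eval ![-x, -y] p = eval ![x, y] p := by
    simpa [hw.neg_one_pow] using hhom.eval_smul_pair (-1) x y
  have hY (x y : ℚ) : eval ![x, -y] p = eval ![x, y] p := by
    rw [← hX x (-y), hneg]
  have hX' (x y z : ℚ) : eval ![x - y, z] p = eval ![y - x, z] p := by
    rw [← hX, neg_sub]
  have hY' (x y z : ℚ) : eval ![z, x - y] p = eval ![z, y - x] p := by
    rw [← hY, neg_sub]
  constructor
  · intro h
    have hE (x y : ℚ) : eval ![x, x + y] p + eval ![x + y, y] p
        - eval ![x, x - y] p - eval ![x - y, y] p = 0 := by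
      have := (eq_zero_iff_eval_pair _).mp h x y
      simpa [eval_sub2, neg_add_eq_sub, hX, hY' y x, hX' y x] using this
    have hr : p + sub2 (X 0 - X 1) (X 0) p + sub2 (-X 1) (X 0 - X 1) p = 0 := by
      have h0 := isHomogeneous_X ℚ (0 : Fin 2)
      have h1 := isHomogeneous_X ℚ (1 : Fin 2)
      have key (x y : ℚ) : eval ![x, -y] p + eval ![x + y, x] p + eval ![y, x + y] p
          = eval ![x, y] p + eval ![x - y, x] p + eval ![y, x - y] p := by
        have := hE y x
        rw [add_comm y x, hY' y x, hX' y x] at this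
        rw [hY]
        linear_combination this
      have hrY (x y : ℚ) :
          eval ![x, -y] (p + sub2 (X 0 - X 1) (X 0) p + sub2 (-X 1) (X 0 - X 1) p) =
            eval ![x, y] (p + sub2 (X 0 - X 1) (X 0) p + sub2 (-X 1) (X 0 - X 1) p) := by
        simpa [eval_sub2, hX] using key x y
      have hhomr : (p + sub2 (X 0 - X 1) (X 0) p + sub2 (-X 1) (X 0 - X 1) p).IsHomogeneous w :=
        (hhom.add (sub2_isHomogeneous hhom (h0.sub h1) h0)).add
          (sub2_isHomogeneous hhom h1.neg (h0.sub h1))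
      refine eq_zero_of_even_of_invariant hpos hhomr (fun x y => ?_) hrY fun x y => ?_
      · rw [← hrY x y]
        simpa [hw.neg_one_pow] using hhomr.eval_smul_pair (-1) x (-y)
      · simp only [map_add, eval_sub2, map_sub, map_neg, eval_X, Matrix.cons_val_zero,
          Matrix.cons_val_one, hX, hY, sub_sub_cancel_left]
        ring
    refine ⟨hr, (eq_zero_iff_eval_pair _).mpr fun x y => ?_⟩
    have := (eq_zero_iff_eval_pair _).mp hr y x
    simp only [map_add, eval_sub2, map_sub, map_neg, eval_X, Matrix.cons_val_zero,
      Matrix.cons_val_one, hX, hY, neg_add_eq_sub, hY' y x] at this ⊢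
    linear_combination this
  · rintro ⟨-, h⟩
    refine (eq_zero_iff_eval_pair _).mpr fun x y => ?_
    have h1 := (eq_zero_iff_eval_pair _).mp h x y
    have h2 := (eq_zero_iff_eval_pair _).mp h x (-y)
    simp only [map_add, eval_sub2, map_sub, map_neg, eval_X, Matrix.cons_val_zero,
      Matrix.cons_val_one, hX, hY, neg_add_eq_sub, hX' _ x, hY' y x, sub_neg_eq_add] at h1 h2 ⊢
    linear_combination h2 - h1
end
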